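/- Let n₁ < n₂ be positive integers and write λ₁ = λ_{n₁}, λ₂ = λ_{n₂}. Let x, y, w, z be nonzero reals and set u = x·e_{n₁} + y·e_{n₂} and v = w·e_{n₁} + z·e_{n₂}. Then (u, v) is a solution of the double-beam system satisfying ∫₀¹ u'(s)² ds = ∫₀¹ v'(s)² ds if and only if one of the following two (mutually exclusive) alternatives holds: (i) λ₁·λ₂ = 2k, w = −x, z = −y, and ϱ·x²·λ₁ + ϱ·y²·λ₂ + λ₁ + λ₂ + β = 0; or (ii) λ₁·(λ₂ − λ₁) = 2k, w = −x, z = y, and ϱ·x²·λ₁ + ϱ·y²·λ₂ + λ₂ + β = 0. -/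

import Mathlib

open Real Set

noncomputable def ee (n : ℕ) : ℝ → ℝ := fun x => Real.sqrt 2 * Real.sin (n * Real.pi * x)

noncomputable def lam (n : ℕ) : ℝ := (n : ℝ) ^ 2 * Real.pi ^ 2

noncomputable def energy (u : ℝ → ℝ) : ℝ := ∫ s in (0:ℝ)..1, (deriv u s) ^ 2

/-- `(u, v)` is a solution of the double-beam system with parameters `β ϱ k`. -/
def DBSol (β ϱ k : ℝ) (u v : ℝ → ℝ) : Prop :=
  ContDiff ℝ 4 u ∧ ContDiff ℝ 4 v ∧
  (∀ x ∈ Set.Icc (0:ℝ) 1,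
    iteratedDeriv 4 u x - (β + ϱ * energy u) * iteratedDeriv 2 u x + k * (u x - v x) = 0) ∧
  (∀ x ∈ Set.Icc (0:ℝ) 1,
    iteratedDeriv 4 v x - (β + ϱ * energy v) * iteratedDeriv 2 v x - k * (u x - v x) = 0) ∧
  u 0 = 0 ∧ u 1 = 0 ∧ iteratedDeriv 2 u 0 = 0 ∧ iteratedDeriv 2 u 1 = 0 ∧
  v 0 = 0 ∧ v 1 = 0 ∧ iteratedDeriv 2 v 0 = 0 ∧ iteratedDeriv 2 v 1 = 0

lemma ee_natCast_eq_zero (n : ℕ) (m : ℕ) : ee n m = 0 := by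
  have h : (n : ℝ) * Real.pi * m = ((n * m : ℕ) : ℝ) * Real.pi := by push_cast; ring
  simp only [ee, h, Real.sin_nat_mul_pi, mul_zero]

/-- If a combination of two distinct modes vanishes on `[0,1]`, its coefficients vanish. -/
lemma ee_combination_eq_zero_imp {n₁ n₂ : ℕ} (hn₁ : 0 < n₁) (hlt : n₁ < n₂) {a b : ℝ}
    (h : ∀ t ∈ Set.Icc (0:ℝ) 1, a * ee n₁ t + b * ee n₂ t = 0) : a = 0 ∧ b = 0 := by
  have h1 : (0:ℝ) < n₁ := by exact_mod_cast hn₁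
  have h12 : (n₁:ℝ) < n₂ := by exact_mod_cast hlt
  have h2 : (0:ℝ) < n₂ := h1.trans h12
  have h2' : (1:ℝ) ≤ n₂ := by exact_mod_cast (Nat.succ_le_of_lt (hn₁.trans hlt))
  have hs : Real.sqrt 2 ≠ 0 := by positivity
  have ha : a = 0 := by
    have e := h (1 / n₂) ⟨by positivity, by rw [div_le_one h2]; exact h2'⟩
    have e2 : (n₂:ℝ) * Real.pi * (1 / n₂) = Real.pi := by field_simp
    have hpos : 0 < Real.sin (n₁ * Real.pi * (1 / n₂)) := by
      apply Real.sin_pos_of_pos_of_lt_pi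
      · positivity
      · rw [mul_one_div, div_lt_iff₀ h2]
        nlinarith [Real.pi_pos]
    simp only [ee, e2, Real.sin_pi, mul_zero, add_zero] at e
    exact (mul_eq_zero.1 e).resolve_right (mul_ne_zero hs hpos.ne')
  refine ⟨ha, ?_⟩
  have e := h (1 / (2 * n₂)) ⟨by positivity, by rw [div_le_one (by positivity)]; linarith⟩
  have e2 : (n₂:ℝ) * Real.pi * (1 / (2 * n₂)) = Real.pi / 2 := by field_simp
  simp only [ee, e2, Real.sin_pi_div_two, ha, zero_mul, zero_add, mul_one] at e
  simpa [hs] using e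

lemma contDiff_ee (n : ℕ) {m : WithTop ℕ∞} : ContDiff ℝ m (ee n) := by
  unfold ee
  fun_prop

lemma hasDerivAt_ee (n : ℕ) (t : ℝ) :
    HasDerivAt (ee n) (Real.sqrt 2 * (n * Real.pi) * Real.cos (n * Real.pi * t)) t := by
  have h := (((hasDerivAt_id t).const_mul (n * Real.pi)).sin).const_mul (Real.sqrt 2)
  exact h.congr_deriv (by simp only [id]; ring)

lemma iteratedDeriv_two_ee_combination (n₁ n₂ : ℕ) (x y : ℝ) :
    iteratedDeriv 2 (fun t => x * ee n₁ t + y * ee n₂ t) =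
      fun t => (-(lam n₁) * x) * ee n₁ t + (-(lam n₂) * y) * ee n₂ t := by
  have h1 : deriv (fun t => x * ee n₁ t + y * ee n₂ t) = fun t =>
      x * (Real.sqrt 2 * (n₁ * Real.pi) * Real.cos (n₁ * Real.pi * t)) +
        y * (Real.sqrt 2 * (n₂ * Real.pi) * Real.cos (n₂ * Real.pi * t)) :=
    funext fun t => (((hasDerivAt_ee n₁ t).const_mul x).add
      ((hasDerivAt_ee n₂ t).const_mul y)).deriv
  have hcos (n : ℕ) (t : ℝ) : HasDerivAt (fun t : ℝ => Real.cos (n * Real.pi * t))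
      (-Real.sin (n * Real.pi * t) * (n * Real.pi * 1)) t :=
    ((hasDerivAt_id t).const_mul (n * Real.pi)).cos
  rw [iteratedDeriv_succ, iteratedDeriv_one, h1]
  funext t
  refine (((((hcos n₁ t).const_mul _).const_mul x).add
    (((hcos n₂ t).const_mul _).const_mul y)).congr_deriv ?_).deriv
  simp only [ee, lam]
  ring

lemma iteratedDeriv_four_ee_combination (n₁ n₂ : ℕ) (x y : ℝ) :
    iteratedDeriv 4 (fun t => x * ee n₁ t + y * ee n₂ t) =
      fun t => (lam n₁ ^ 2 * x) * ee n₁ t + (lam n₂ ^ 2 * y) * ee n₂ t := by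
  have h (f : ℝ → ℝ) : iteratedDeriv 4 f = iteratedDeriv 2 (iteratedDeriv 2 f) := by
    simp only [iteratedDeriv_eq_iterate, ← Function.iterate_add_apply]
  rw [h, iteratedDeriv_two_ee_combination, iteratedDeriv_two_ee_combination]
  funext t
  ring

lemma energy_ee_combination {n₁ n₂ : ℕ} (hn₁ : 0 < n₁) (hlt : n₁ < n₂) (x y : ℝ) :
    energy (fun t => x * ee n₁ t + y * ee n₂ t) = x ^ 2 * lam n₁ + y ^ 2 * lam n₂ := by
  have h1 : (0:ℝ) < n₁ := by exact_mod_cast hn₁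
  have h12 : (n₁:ℝ) < n₂ := by exact_mod_cast hlt
  have h2 : (0:ℝ) < n₂ := h1.trans h12
  have hd : (0:ℝ) < n₂ - n₁ := sub_pos.2 h12
  have hpi := Real.pi_pos
  have hsin (c t : ℝ) (hc : 0 < c) : HasDerivAt
      (fun t : ℝ => Real.sin (c * Real.pi * t) / (c * Real.pi)) (Real.cos (c * Real.pi * t)) t :=
    ((((hasDerivAt_id t).const_mul (c * Real.pi)).sin).div_const _).congr_deriv (by
      simp only [id]; field_simp)
  have hderiv : deriv (fun t => x * ee n₁ t + y * ee n₂ t) = fun t =>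
      x * (Real.sqrt 2 * (n₁ * Real.pi) * Real.cos (n₁ * Real.pi * t)) +
        y * (Real.sqrt 2 * (n₂ * Real.pi) * Real.cos (n₂ * Real.pi * t)) :=
    funext fun t => (((hasDerivAt_ee n₁ t).const_mul x).add
      ((hasDerivAt_ee n₂ t).const_mul y)).deriv
  have hF (t : ℝ) := (((((hasDerivAt_id t).add (hsin (2 * n₁) t (by positivity))).const_mul
      (x ^ 2 * lam n₁)).add
    (((hasDerivAt_id t).add (hsin (2 * n₂) t (by positivity))).const_mul (y ^ 2 * lam n₂))).add
    (((hsin (n₂ - n₁) t hd).add (hsin (n₂ + n₁) t (by positivity))).const_mul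
      (2 * x * y * n₁ * n₂ * Real.pi ^ 2)))
  unfold energy
  rw [hderiv, intervalIntegral.integral_eq_sub_of_hasDerivAt
    (fun t _ => (hF t).congr_deriv ?_) (Continuous.intervalIntegrable (by fun_prop) _ _)]
  · have s1 : Real.sin (2 * n₁ * Real.pi) = 0 := by exact_mod_cast Real.sin_nat_mul_pi (2 * n₁)
    have s2 : Real.sin (2 * n₂ * Real.pi) = 0 := by exact_mod_cast Real.sin_nat_mul_pi (2 * n₂)
    have s3 : Real.sin ((n₂ - n₁) * Real.pi) = 0 := by
      exact_mod_cast Real.sin_int_mul_pi ((n₂ : ℤ) - n₁)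
    have s4 : Real.sin ((n₂ + n₁) * Real.pi) = 0 := by
      exact_mod_cast Real.sin_nat_mul_pi (n₂ + n₁)
    simp [s1, s2, s3, s4]
  · have hs : Real.sqrt 2 ^ 2 = 2 := Real.sq_sqrt (by norm_num)
    have a1 : (2:ℝ) * n₁ * Real.pi * t = 2 * (n₁ * Real.pi * t) := by ring
    have a2 : (2:ℝ) * n₂ * Real.pi * t = 2 * (n₂ * Real.pi * t) := by ring
    have a3 : ((n₂:ℝ) - n₁) * Real.pi * t = n₂ * Real.pi * t - n₁ * Real.pi * t := by ring
    have a4 : ((n₂:ℝ) + n₁) * Real.pi * t = n₂ * Real.pi * t + n₁ * Real.pi * t := by ring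
    rw [a1, a2, a3, a4, Real.cos_two_mul, Real.cos_two_mul, Real.cos_sub, Real.cos_add]
    simp only [lam]
    ring_nf
    simp only [hs]
    ring

/-- The double-beam system for a bimodal pair is an algebraic system for its coefficients. -/
lemma dbSol_ee_combination_iff {n₁ n₂ : ℕ} (hn₁ : 0 < n₁) (hlt : n₁ < n₂)
    (β ϱ k x y w z : ℝ) :
    DBSol β ϱ k (fun t => x * ee n₁ t + y * ee n₂ t) (fun t => w * ee n₁ t + z * ee n₂ t) ↔
      let C := β + ϱ * (x ^ 2 * lam n₁ + y ^ 2 * lam n₂)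
      let D := β + ϱ * (w ^ 2 * lam n₁ + z ^ 2 * lam n₂)
      lam n₁ ^ 2 * x + C * lam n₁ * x + k * (x - w) = 0 ∧
      lam n₂ ^ 2 * y + C * lam n₂ * y + k * (y - z) = 0 ∧
      lam n₁ ^ 2 * w + D * lam n₁ * w - k * (x - w) = 0 ∧
      lam n₂ ^ 2 * z + D * lam n₂ * z - k * (y - z) = 0 := by
  have e0 (n : ℕ) : ee n 0 = 0 := by exact_mod_cast ee_natCast_eq_zero n 0
  have e1 (n : ℕ) : ee n 1 = 0 := by exact_mod_cast ee_natCast_eq_zero n 1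
  have hsmooth (a b : ℝ) : ContDiff ℝ 4 (fun t => a * ee n₁ t + b * ee n₂ t) :=
    (contDiff_const.mul (contDiff_ee n₁)).add (contDiff_const.mul (contDiff_ee n₂))
  simp only [DBSol, energy_ee_combination hn₁ hlt, iteratedDeriv_two_ee_combination,
    iteratedDeriv_four_ee_combination, e0, e1, hsmooth, mul_zero, add_zero, true_and, and_true]
  constructor
  · rintro ⟨hu, hv⟩
    obtain ⟨p, q⟩ := ee_combination_eq_zero_imp hn₁ hlt
      (fun t ht => (show _ = _ by ring : _).trans (hu t ht) :
        ∀ t ∈ Set.Icc (0:ℝ) 1,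
          (lam n₁ ^ 2 * x + (β + ϱ * (x ^ 2 * lam n₁ + y ^ 2 * lam n₂)) * lam n₁ * x
            + k * (x - w)) * ee n₁ t +
          (lam n₂ ^ 2 * y + (β + ϱ * (x ^ 2 * lam n₁ + y ^ 2 * lam n₂)) * lam n₂ * y
            + k * (y - z)) * ee n₂ t = 0)
    obtain ⟨r, s⟩ := ee_combination_eq_zero_imp hn₁ hlt
      (fun t ht => (show _ = _ by ring : _).trans (hv t ht) :
        ∀ t ∈ Set.Icc (0:ℝ) 1,
          (lam n₁ ^ 2 * w + (β + ϱ * (w ^ 2 * lam n₁ + z ^ 2 * lam n₂)) * lam n₁ * w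
            - k * (x - w)) * ee n₁ t +
          (lam n₂ ^ 2 * z + (β + ϱ * (w ^ 2 * lam n₁ + z ^ 2 * lam n₂)) * lam n₂ * z
            - k * (y - z)) * ee n₂ t = 0)
    exact ⟨p, q, r, s⟩
  · rintro ⟨p, q, r, s⟩
    exact ⟨fun t _ => by linear_combination ee n₁ t * p + ee n₂ t * q,
      fun t _ => by linear_combination ee n₁ t * r + ee n₂ t * s⟩

/-- For one mode, the coefficients of the two beams are equal or opposite. -/
lemma mode_coeff_dichotomy {l C k x w : ℝ} (hl : 0 < l) (hx : x ≠ 0)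
    (hp : l ^ 2 * x + C * l * x + k * (x - w) = 0)
    (hr : l ^ 2 * w + C * l * w - k * (x - w) = 0) :
    (w = -x ∧ l ^ 2 + C * l + 2 * k = 0) ∨ (C = -l ∧ k * (x - w) = 0) := by
  have hsum : (x + w) * (l * (l + C)) = 0 := by linear_combination hp + hr
  rcases mul_eq_zero.1 hsum with h | h
  · left
    have hw : w = -x := by linarith
    refine ⟨hw, mul_left_cancel₀ hx ?_⟩
    subst hw
    linear_combination hp
  · right
    have hC : C = -l := by
      have := (mul_eq_zero.1 h).resolve_left hl.ne'
      linarith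
    refine ⟨hC, ?_⟩
    subst hC
    linear_combination hp

theorem stmt8 (β ϱ k : ℝ) (hϱ : 0 < ϱ) (hk : 0 < k)
    (n₁ n₂ : ℕ) (hn₁ : 0 < n₁) (hlt : n₁ < n₂)
    (l₁ l₂ : ℝ) (hl₁ : l₁ = lam n₁) (hl₂ : l₂ = lam n₂)
    (x y w z : ℝ) (hx : x ≠ 0) (hy : y ≠ 0) (hw : w ≠ 0) (hz : z ≠ 0)
    (u v : ℝ → ℝ)
    (hu : u = fun t => x * ee n₁ t + y * ee n₂ t)
    (hv : v = fun t => w * ee n₁ t + z * ee n₂ t) :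
    ((DBSol β ϱ k u v ∧ energy u = energy v) ↔
      ((l₁ * l₂ = 2 * k ∧ w = -x ∧ z = -y ∧
          ϱ * x ^ 2 * l₁ + ϱ * y ^ 2 * l₂ + l₁ + l₂ + β = 0) ∨
       (l₁ * (l₂ - l₁) = 2 * k ∧ w = -x ∧ z = y ∧
          ϱ * x ^ 2 * l₁ + ϱ * y ^ 2 * l₂ + l₂ + β = 0))) ∧
    ¬((l₁ * l₂ = 2 * k ∧ w = -x ∧ z = -y ∧
          ϱ * x ^ 2 * l₁ + ϱ * y ^ 2 * l₂ + l₁ + l₂ + β = 0) ∧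
      (l₁ * (l₂ - l₁) = 2 * k ∧ w = -x ∧ z = y ∧
          ϱ * x ^ 2 * l₁ + ϱ * y ^ 2 * l₂ + l₂ + β = 0)) := by
  have h1 : (0:ℝ) < n₁ := by exact_mod_cast hn₁
  have h12 : (n₁:ℝ) < n₂ := by exact_mod_cast hlt
  have hl₁pos : 0 < l₁ := by rw [hl₁, lam]; positivity
  have hl : l₁ < l₂ := by
    rw [hl₁, hl₂, lam, lam]
    gcongr
  have hl₂pos : 0 < l₂ := hl₁pos.trans hl
  rw [hu, hv, dbSol_ee_combination_iff hn₁ hlt, energy_ee_combination hn₁ hlt,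
    energy_ee_combination hn₁ hlt, ← hl₁, ← hl₂]
  refine ⟨⟨?_, ?_⟩, ?_⟩
  · rintro ⟨⟨p, q, r, s⟩, hE⟩
    rw [← hE] at r s
    generalize hC : β + ϱ * (x ^ 2 * l₁ + y ^ 2 * l₂) = C at p q r s
    rcases mode_coeff_dichotomy hl₁pos hx p r with ⟨hw', c⟩ | ⟨hC', c⟩ <;>
    rcases mode_coeff_dichotomy hl₂pos hy q s with ⟨hz', d⟩ | ⟨hC'', d⟩
    · left
      have hsum : l₁ + l₂ + C = 0 := by
        refine mul_left_cancel₀ (sub_pos.2 hl).ne' ?_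
        linear_combination d - c
      exact ⟨by linear_combination l₁ * hsum - c, hw', hz', by linear_combination hsum + hC⟩
    · right
      have hyz := (mul_eq_zero.1 d).resolve_left hk.ne'
      subst hC''
      exact ⟨by linear_combination -c, hw', by linarith, by linear_combination hC⟩
    · subst hC'
      nlinarith [mul_pos hl₂pos (sub_pos.2 hl)]
    · linarith
  · rintro (⟨hk', rfl, rfl, h⟩ | ⟨hk', rfl, rfl, h⟩)
    · refine ⟨⟨?_, ?_, ?_, ?_⟩, by ring⟩
      · linear_combination l₁ * x * h - x * hk'
      · linear_combination l₂ * y * h - y * hk'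
      · linear_combination -l₁ * x * h + x * hk'
      · linear_combination -l₂ * y * h + y * hk'
    · refine ⟨⟨?_, ?_, ?_, ?_⟩, by ring⟩
      · linear_combination l₁ * x * h - x * hk'
      · linear_combination l₂ * z * h
      · linear_combination -l₁ * x * h + x * hk'
      · linear_combination l₂ * z * h
  · rintro ⟨⟨-, -, hz₁, -⟩, -, -, hz₂, -⟩
    exact hy (by linarith)
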